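/- Let F be a finite field with 729 elements. There exists an F-linear subspace C of F^{6075} of dimension at least 6032 such that every nonzero element of C has Hamming weight at least 13; i.e., a linear [6075, 6032, ≥13]-code over F_{729} exists. -/

import Mathlib

open Polynomial in
/-- If the first `d` power sums of a vector, weighted by distinct points of an extension field,
vanish, then a nonzero vector has weight greater than `d`. -/
theorem lt_hammingNorm_of_sum_smul_pow_eq_zero {ι F K : Type*} [Fintype ι]
    [Field F] [DecidableEq F] [Field K] [Algebra F K] {a : ι → K} (ha : Function.Injective a)
    {d : ℕ} {x : ι → F} (hx : x ≠ 0) (h : ∀ j < d, ∑ i, x i • a i ^ j = 0) :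
    d < hammingNorm x := by
  classical
  by_contra! hd
  obtain ⟨i₀, hi₀⟩ := Function.ne_iff.mp hx
  have hmem : i₀ ∈ Finset.univ.filter (fun i => x i ≠ 0) := by simpa using hi₀
  set S := (Finset.univ.filter (fun i => x i ≠ 0)).erase i₀ with hS
  have hcard : S.card < d := (Finset.card_erase_lt_of_mem hmem).trans_le hd
  set p : K[X] := ∏ i ∈ S, (X - C (a i)) with hp
  have hdeg : p.natDegree < d := by
    rwa [hp, natDegree_finsetProd_X_sub_C_eq_card]
  have hsum : ∑ i, x i • p.eval (a i) = 0 := by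
    simp_rw [eval_eq_sum_range' hdeg, Finset.smul_sum]
    rw [Finset.sum_comm]
    refine Finset.sum_eq_zero fun j hj => ?_
    simp_rw [← mul_smul_comm, ← Finset.mul_sum, h j (Finset.mem_range.mp hj), mul_zero]
  have hsingle : ∑ i, x i • p.eval (a i) = x i₀ • p.eval (a i₀) := by
    refine Fintype.sum_eq_single i₀ fun i hi => ?_
    by_cases hxi : x i = 0
    · rw [hxi, zero_smul]
    · have hiS : i ∈ S := by simp [hS, hi, hxi]
      rw [hp, eval_prod, Finset.prod_eq_zero hiS (by simp), smul_zero]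
  have hne : p.eval (a i₀) ≠ 0 := by
    rw [hp, eval_prod, Finset.prod_ne_zero_iff]
    intro i hi
    rw [eval_sub, eval_X, eval_C, sub_ne_zero]
    exact ha.ne (Finset.ne_of_mem_erase hi).symm
  exact smul_ne_zero hi₀ hne (hsingle.symm.trans hsum)

/-- Subfield subcodes of Reed-Solomon codes: over a field `F` with an extension `K` of degree `m`
containing `n` distinct points, there is a code of length `n`, of codimension at most `d * m`,
whose nonzero words have weight greater than `d`. -/
theorem exists_submodule_lt_hammingNorm {ι F K : Type*} [Fintype ι]
    [Field F] [DecidableEq F] [Field K] [Algebra F K] [FiniteDimensional F K]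
    (a : ι ↪ K) (d : ℕ) :
    ∃ C : Submodule F (ι → F),
      Fintype.card ι ≤ Module.finrank F C + d * Module.finrank F K ∧
      ∀ x ∈ C, x ≠ 0 → d < hammingNorm x := by
  let f : (ι → F) →ₗ[F] (Fin d → K) :=
    LinearMap.pi fun j => Fintype.linearCombination F fun i => a i ^ (j : ℕ)
  refine ⟨LinearMap.ker f, ?_, fun x hx hx0 => ?_⟩
  · have hrank := f.finrank_range_add_finrank_ker
    have hle := Submodule.finrank_le (LinearMap.range f)
    rw [Module.finrank_pi_fintype, Finset.sum_const, Finset.card_univ, Fintype.card_fin,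
      smul_eq_mul] at hle
    rw [Module.finrank_fintype_fun_eq_card] at hrank
    lia
  · refine lt_hammingNorm_of_sum_smul_pow_eq_zero a.injective hx0 fun j hj => ?_
    exact congrFun (LinearMap.mem_ker.mp hx) ⟨j, hj⟩

theorem code_6075_6032_13
    (F : Type*) [Field F] [Fintype F] [DecidableEq F] (hF : Fintype.card F = 729) :
    ∃ C : Submodule F (Fin 6075 → F),
      6032 ≤ Module.finrank F C ∧
      ∀ x ∈ C, x ≠ 0 → 13 ≤ hammingNorm x := by
  have : Fact (Nat.Prime 3) := ⟨Nat.prime_three⟩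
  have : CharP F 3 := charP_of_card_eq_prime_pow (f := 6) (by simpa using hF)
  let K := FiniteField.Extension F 3 2
  have hfin : Module.finrank F K = 2 := FiniteField.finrank_extension F 3 2
  have : Finite K := Module.finite_of_finite F
  have := Fintype.ofFinite K
  have hK : Fintype.card K = 729 ^ 2 := by
    rw [Module.card_eq_pow_finrank (K := F), hfin, hF]
  obtain ⟨a⟩ : Nonempty (Fin 6075 ↪ K) :=
    Function.Embedding.nonempty_of_card_le (by rw [hK, Fintype.card_fin]; norm_num)
  obtain ⟨C, hC, hw⟩ := exists_submodule_lt_hammingNorm (F := F) a 12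
  rw [hfin, Fintype.card_fin] at hC
  exact ⟨C, by lia, hw⟩
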